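/- arXiv:1508.04127 — 2 statements merged into one kernel-verified Lean document; each statement's English description precedes it below -/
import Mathlib

section
/- Let A = (A_1, …, A_K) be a measurable partition of 𝒳 with operating point u = (u_1, …, u_K). Then the expected reduction in differential entropy under the Bayes update satisfies H(p) − Σ_{y∈𝒴} η(y) H(p_y) = φ(u), i.e. it equals 𝓗(Σ_{k=1}^K u_k f_k) − Σ_{k=1}^K u_k 𝓗(f_k). (Proposition 1 of the paper.) -/
open MeasureTheory Finset Real

/-- Shannon entropy of a function on a finite set (convention `0 * log 0 = 0`
is automatic since `Real.log 0 = 0`). -/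
noncomputable def shannonEntropy {S : Type*} [Fintype S] (f : S → ℝ) : ℝ :=
  -∑ s, f s * Real.log (f s)

/-- `f` is a probability mass function on the finite set `S`. -/
def IsPmf {S : Type*} [Fintype S] (f : S → ℝ) : Prop :=
  (∀ s, 0 ≤ f s) ∧ ∑ s, f s = 1

/-- `φ(u) = 𝓗(Σ_k u_k f_k) − Σ_k u_k 𝓗(f_k)`. -/
noncomputable def phiGen {I Y : Type*} [Fintype I] [Fintype Y]
    (f : I → Y → ℝ) (u : I → ℝ) : ℝ :=
  shannonEntropy (fun y => ∑ k, u k * f k y) - ∑ k, u k * shannonEntropy (f k)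

/-- Differential entropy of a density `p` on the region `X`. -/
noncomputable def diffEntropy {α : Type*} [MeasureSpace α] (X : Set α) (p : α → ℝ) : ℝ :=
  -∫ x in X, p x * Real.log (p x)

/-- Bayes posterior density after observing `y` using the sensing partition `A`:
`p_y(x) = p(x) f_{k(x)}(y) / η(y)` where `η(y) = Σ_k u_k f_k(y)`,
`u_k = ∫_{A_k} p`, and `k(x)` is the index of the partition set containing `x`;
`p_y = p` when `η(y) = 0`. -/
noncomputable def bayesPost {α : Type*} [MeasureSpace α] {K : ℕ} {Y : Type*} [Fintype Y]
    (p : α → ℝ) (A : Fin K → Set α) (f : Fin K → Y → ℝ) (y : Y) : α → ℝ :=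
  if (∑ k, (∫ x in A k, p x) * f k y) = 0 then p
  else fun x =>
    p x * (∑ k, (A k).indicator (fun _ => f k y) x) / (∑ k, (∫ x in A k, p x) * f k y)

/-- **Proposition 1.** For a measurable partition `A = (A_1, …, A_K)` of `𝒳` with
operating point `u_k = ∫_{A_k} p`, the expected reduction in differential entropy
under the Bayes update equals `φ(u)`. -/
theorem expected_entropy_reduction_eq_phi
    {d K : ℕ} (hK : 2 ≤ K) {Y : Type*} [Fintype Y] [Nonempty Y]
    (X : Set (Fin d → ℝ)) (hX : IsCompact X)
    (f : Fin K → Y → ℝ) (hf : ∀ k, IsPmf (f k))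
    (p : (Fin d → ℝ) → ℝ)
    (hp0 : ∀ x, 0 ≤ p x)
    (hpsupp : ∀ x ∉ X, p x = 0)
    (hp1 : ∫ x in X, p x = 1)
    (hpInt : Integrable p (volume.restrict X))
    (hpEnt : Integrable (fun x => p x * Real.log (p x)) (volume.restrict X))
    (A : Fin K → Set (Fin d → ℝ))
    (hAm : ∀ k, MeasurableSet (A k))
    (hAdisj : Pairwise fun k k' => Disjoint (A k) (A k'))
    (hAcover : (⋃ k, A k) = X)
    (hPostEnt : ∀ y : Y,
      Integrable (fun x => bayesPost p A f y x * Real.log (bayesPost p A f y x))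
        (volume.restrict X)) :
    diffEntropy X p -
        ∑ y : Y, (∑ k, (∫ x in A k, p x) * f k y) * diffEntropy X (bayesPost p A f y)
      = phiGen f (fun k => ∫ x in A k, p x) := by
  classical
  have hAX : ∀ k, A k ⊆ X := fun k => hAcover ▸ Set.subset_iUnion A k
  have hsplit : ∀ g : (Fin d → ℝ) → ℝ, Integrable g (volume.restrict X) →
      ∫ x in X, g x = ∑ k, ∫ x in A k, g x := by
    intro g hg
    rw [← hAcover]
    exact integral_iUnion_fintype hAm hAdisj (fun k => IntegrableOn.mono_set hg (hAX k))
  have hpA : ∀ k, Integrable p (volume.restrict (A k)) := fun k =>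
    IntegrableOn.mono_set hpInt (hAX k)
  have hhA : ∀ k, Integrable (fun x => p x * Real.log (p x)) (volume.restrict (A k)) := fun k =>
    IntegrableOn.mono_set hpEnt (hAX k)
  have hu0 : ∀ k, 0 ≤ ∫ x in A k, p x := fun k => integral_nonneg hp0
  have hzero : ∀ k, (∫ x in A k, p x) = 0 → (∫ x in A k, p x * Real.log (p x)) = 0 := by
    intro k hk
    have h := (integral_eq_zero_iff_of_nonneg hp0 (hpA k)).1 hk
    apply integral_eq_zero_of_ae
    filter_upwards [h] with x hx
    simp only [Pi.zero_apply] at hx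
    simp [hx]
  have key : ∀ y, (∑ k, (∫ x in A k, p x) * f k y) * diffEntropy X (bayesPost p A f y)
      = (∑ k, (∫ x in A k, p x) * f k y) * Real.log (∑ k, (∫ x in A k, p x) * f k y)
        - ∑ k, (f k y * (∫ x in A k, p x * Real.log (p x))
          + (∫ x in A k, p x) * (f k y * Real.log (f k y))) := by
    intro y
    by_cases hη : (∑ k, (∫ x in A k, p x) * f k y) = 0
    · have h0 := (Finset.sum_eq_zero_iff_of_nonneg
        (fun k _ => mul_nonneg (hu0 k) ((hf k).1 y))).1 hη
      rw [hη, zero_mul, zero_mul, zero_sub, eq_comm, neg_eq_zero]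
      apply Finset.sum_eq_zero
      intro k hk
      rcases mul_eq_zero.1 (h0 k hk) with h | h
      · rw [hzero k h, h]; simp
      · rw [h]; simp
    · unfold diffEntropy
      rw [hsplit _ (hPostEnt y)]
      have hk : ∀ k, ∫ x in A k, bayesPost p A f y x * Real.log (bayesPost p A f y x)
          = (f k y / (∑ k, (∫ x in A k, p x) * f k y)) * (∫ x in A k, p x * Real.log (p x))
          + ((f k y / (∑ k, (∫ x in A k, p x) * f k y)) *
            (Real.log (f k y) - Real.log (∑ k, (∫ x in A k, p x) * f k y)))
              * ∫ x in A k, p x := by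
        intro k
        rw [← integral_const_mul, ← integral_const_mul,
          ← integral_add ((hhA k).const_mul _) ((hpA k).const_mul _)]
        apply setIntegral_congr_fun (hAm k)
        intro x hx
        have hs : (∑ j, (A j).indicator (fun _ => f j y) x) = f k y := by
          rw [Finset.sum_eq_single k]
          · simp [hx]
          · intro j _ hj
            exact Set.indicator_of_notMem
              (fun h => Set.disjoint_left.1 (hAdisj hj) h hx) _
          · simp
        simp only [bayesPost, if_neg hη, hs]
        generalize (∑ k, (∫ x in A k, p x) * f k y) = e at hη
        by_cases hpx : p x = 0
        · simp [hpx]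
        by_cases hc : f k y = 0
        · simp [hc]
        rw [Real.log_div (mul_ne_zero hpx hc) hη, Real.log_mul hpx hc]
        ring
      rw [Finset.sum_congr rfl (fun k _ => hk k)]
      rw [mul_neg, Finset.mul_sum]
      conv_rhs => rw [Finset.sum_mul]
      rw [← Finset.sum_sub_distrib, ← Finset.sum_neg_distrib]
      apply Finset.sum_congr rfl
      intro k _
      generalize (∑ k, (∫ x in A k, p x) * f k y) = e at hη
      field_simp
      ring
  rw [Finset.sum_congr rfl (fun y _ => key y)]
  unfold diffEntropy phiGen shannonEntropy
  rw [hsplit _ hpEnt, Finset.sum_sub_distrib, Finset.sum_comm (s := Finset.univ (α := Y))]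
  simp only [Finset.sum_add_distrib, ← Finset.sum_mul, ← Finset.mul_sum, (hf _).2, one_mul,
    mul_neg, Finset.sum_neg_distrib]
  ring
end

section
/- Let X be distributed on 𝒳 with density p_0, and run any policy of horizon at least n; let p_{(Y_1,…,Y_n)} denote the (random) posterior density after n stages and X̂_n = ∫_𝒳 x · p_{(Y_1,…,Y_n)}(x) dx the conditional-mean estimator. If all posterior densities have finite differential entropy and finite second moments, then E[‖X − X̂_n‖_2²] ≥ (d · C_0^{1/d} / (2πe)) · e^{−2nφ*/d}, where C_0 = e^{2H(p_0)} and φ* = max_{u ∈ Δ_K} φ(u). (Proposition 3 of the paper: mean-square error lower bound.) -/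
open MeasureTheory Finset Real

/-- Posterior density after observing history `ys` under `policy`. -/
noncomputable def postSeq {α : Type*} [MeasureSpace α] {K : ℕ} {Y : Type*} [Fintype Y]
    (f : Fin K → Y → ℝ) :
    (List Y → Fin K → Set α) → (α → ℝ) → List Y → (α → ℝ)
  | _, p, [] => p
  | policy, p, y :: ys =>
      postSeq f (fun h => policy (y :: h)) (bayesPost p (policy []) f y) ys

/-- Probability of observing the sequence `ys` under `policy`. -/
noncomputable def seqProb {α : Type*} [MeasureSpace α] {K : ℕ} {Y : Type*} [Fintype Y]
    (f : Fin K → Y → ℝ) :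
    (List Y → Fin K → Set α) → (α → ℝ) → List Y → ℝ
  | _, _, [] => 1
  | policy, p, y :: ys =>
      (∑ k, (∫ x in policy [] k, p x) * f k y) *
        seqProb f (fun h => policy (y :: h)) (bayesPost p (policy []) f y) ys

/-- Invariant of a density on `X` with finite entropy. -/
structure GoodDensity {α : Type*} [MeasureSpace α] (X : Set α) (p : α → ℝ) : Prop where
  nonneg : ∀ x, 0 ≤ p x
  int : IntegrableOn p X
  one : ∫ x in X, p x = 1
  ent : IntegrableOn (fun x => p x * Real.log (p x)) X

/-- Measurable partition of `X`. -/
def IsPart {α : Type*} [MeasurableSpace α] {K : ℕ} (X : Set α) (A : Fin K → Set α) : Prop :=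
  (∀ k, MeasurableSet (A k)) ∧ (Pairwise fun k k' => Disjoint (A k) (A k')) ∧ (⋃ k, A k) = X

lemma bayesPost_eq {α : Type*} [MeasureSpace α] {K : ℕ} {Y : Type*} [Fintype Y]
    {X : Set α} {p : α → ℝ} {A : Fin K → Set α} (hA : IsPart X A) (f : Fin K → Y → ℝ) (y : Y)
    (hη : (∑ k, (∫ x in A k, p x) * f k y) ≠ 0) (k : Fin K) {x : α} (hx : x ∈ A k) :
    bayesPost p A f y x = p x * (f k y / ∑ k, (∫ x in A k, p x) * f k y) := by
  unfold bayesPost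
  rw [if_neg hη]
  have : (∑ k, (A k).indicator (fun _ => f k y) x) = f k y := by
    rw [Finset.sum_eq_single k]
    · simp [hx]
    · intro j _ hj
      have := Set.disjoint_left.1 (hA.2.1 hj.symm) hx
      simp [this]
    · simp
  simp only [this]
  ring

lemma plogp {p c η : ℝ} (hη : 0 < η) :
    (p * (c / η)) * Real.log (p * (c / η)) =
      (c / η) * (p * Real.log p) + ((c / η) * (Real.log c - Real.log η)) * p := by
  by_cases h1 : p = 0
  · simp [h1]
  by_cases h2 : c = 0
  · simp [h2]
  rw [Real.log_mul h1 (by positivity), Real.log_div h2 hη.ne']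
  ring

section step
variable {α : Type*} [MeasureSpace α] {K : ℕ} {Y : Type*} [Fintype Y]
    {X : Set α} {p : α → ℝ} {A : Fin K → Set α}

lemma part_intOn (hA : IsPart X A) {g : α → ℝ} :
    IntegrableOn g X ↔ ∀ k, IntegrableOn g (A k) := by
  rw [← hA.2.2]; exact integrableOn_finite_iUnion

lemma part_int (hA : IsPart X A) {g : α → ℝ} (hg : ∀ k, IntegrableOn g (A k)) :
    ∫ x in X, g x = ∑ k, ∫ x in A k, g x := by
  rw [← hA.2.2]; exact integral_iUnion_fintype hA.1 hA.2.1 hg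

lemma u_simplex (hA : IsPart X A) (hp : GoodDensity X p) :
    (fun k => ∫ x in A k, p x) ∈ stdSimplex ℝ (Fin K) := by
  refine ⟨fun k => integral_nonneg hp.nonneg, ?_⟩
  rw [← hp.one, part_int hA ((part_intOn hA).1 hp.int)]

lemma eta_nonneg (hp : GoodDensity X p) {f : Fin K → Y → ℝ} (hf : ∀ k, IsPmf (f k)) (y : Y) :
    0 ≤ ∑ k, (∫ x in A k, p x) * f k y :=
  Finset.sum_nonneg fun k _ => mul_nonneg (integral_nonneg hp.nonneg) ((hf k).1 y)

lemma eta_sum (hA : IsPart X A) (hp : GoodDensity X p) {f : Fin K → Y → ℝ}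
    (hf : ∀ k, IsPmf (f k)) :
    ∑ y, ∑ k, (∫ x in A k, p x) * f k y = 1 := by
  rw [Finset.sum_comm]
  simp_rw [← Finset.mul_sum, (hf _).2, mul_one]
  exact (u_simplex hA hp).2

lemma bayes_ent (hA : IsPart X A) (hp : GoodDensity X p) {f : Fin K → Y → ℝ}
    (hf : ∀ k, IsPmf (f k)) (y : Y) (hη : (∑ k, (∫ x in A k, p x) * f k y) ≠ 0) (k : Fin K) :
    IntegrableOn (fun x => bayesPost p A f y x * Real.log (bayesPost p A f y x)) (A k) ∧
    ∫ x in A k, bayesPost p A f y x * Real.log (bayesPost p A f y x) =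
      (f k y / ∑ k, (∫ x in A k, p x) * f k y) * (∫ x in A k, p x * Real.log (p x)) +
      ((f k y / ∑ k, (∫ x in A k, p x) * f k y) *
        (Real.log (f k y) - Real.log (∑ k, (∫ x in A k, p x) * f k y))) * ∫ x in A k, p x := by
  have hpos := lt_of_le_of_ne (eta_nonneg (A := A) hp hf y) hη.symm
  have hi1 := (part_intOn hA).1 hp.int k
  have hi2 := (part_intOn hA).1 hp.ent k
  have heq : Set.EqOn (fun x => bayesPost p A f y x * Real.log (bayesPost p A f y x))
      (fun x => (f k y / ∑ k, (∫ x in A k, p x) * f k y) * (p x * Real.log (p x)) +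
      ((f k y / ∑ k, (∫ x in A k, p x) * f k y) *
        (Real.log (f k y) - Real.log (∑ k, (∫ x in A k, p x) * f k y))) * p x) (A k) := by
    intro x hx
    simp only
    rw [bayesPost_eq hA f y hη k hx, plogp hpos]
  have I1 := hi2.integrable.const_mul (f k y / ∑ k, (∫ x in A k, p x) * f k y)
  have I2 := hi1.integrable.const_mul ((f k y / ∑ k, (∫ x in A k, p x) * f k y) *
        (Real.log (f k y) - Real.log (∑ k, (∫ x in A k, p x) * f k y)))
  constructor
  · rw [integrableOn_congr_fun heq (hA.1 k)]
    exact I1.add I2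
  · rw [setIntegral_congr_fun (hA.1 k) heq, integral_add I1 I2, integral_const_mul,
      integral_const_mul]

lemma bayes_good (hA : IsPart X A) (hp : GoodDensity X p) {f : Fin K → Y → ℝ}
    (hf : ∀ k, IsPmf (f k)) (y : Y) : GoodDensity X (bayesPost p A f y) := by
  by_cases hη : (∑ k, (∫ x in A k, p x) * f k y) = 0
  · have : bayesPost p A f y = p := by unfold bayesPost; rw [if_pos hη]
    rwa [this]
  have hi1 := (part_intOn hA).1 hp.int
  have heq : ∀ k, Set.EqOn (bayesPost p A f y)
      (fun x => p x * (f k y / ∑ k, (∫ x in A k, p x) * f k y)) (A k) :=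
    fun k x hx => bayesPost_eq hA f y hη k hx
  have hI : ∀ k, IntegrableOn (bayesPost p A f y) (A k) := by
    intro k
    rw [integrableOn_congr_fun (heq k) (hA.1 k)]
    exact (hi1 k).integrable.mul_const _
  refine ⟨?_, (part_intOn hA).2 hI, ?_, (part_intOn hA).2 fun k => (bayes_ent hA hp hf y hη k).1⟩
  · intro x
    unfold bayesPost
    rw [if_neg hη]
    refine div_nonneg (mul_nonneg (hp.nonneg x) (Finset.sum_nonneg fun k _ => ?_))
      (eta_nonneg hp hf y)
    exact Set.indicator_nonneg (fun _ _ => (hf k).1 y) x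
  · rw [part_int hA hI]
    simp_rw [fun k => setIntegral_congr_fun (μ := volume) (hA.1 k) (heq k), integral_mul_const,
      ← mul_div_assoc]
    rw [← Finset.sum_div, div_self hη]

lemma bayes_ent_y (hA : IsPart X A) (hp : GoodDensity X p) {f : Fin K → Y → ℝ}
    (hf : ∀ k, IsPmf (f k)) (y : Y) :
    (∑ k, (∫ x in A k, p x) * f k y) * diffEntropy X (bayesPost p A f y) =
      ∑ k, (- (f k y * ∫ x in A k, p x * Real.log (p x))
        - (∫ x in A k, p x) * (f k y * Real.log (f k y))
        + ((∫ x in A k, p x) * f k y) * Real.log (∑ k, (∫ x in A k, p x) * f k y)) := by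
  by_cases hη : (∑ k, (∫ x in A k, p x) * f k y) = 0
  · rw [hη, zero_mul, eq_comm]
    refine Finset.sum_eq_zero fun k _ => ?_
    have h0 := (Finset.sum_eq_zero_iff_of_nonneg (fun k _ =>
      mul_nonneg (integral_nonneg (μ := volume.restrict (A k)) hp.nonneg) ((hf k).1 y))).1 hη k
        (Finset.mem_univ k)
    rcases mul_eq_zero.1 h0 with h | h
    · have h' := (setIntegral_eq_zero_iff_of_nonneg_ae
        (Filter.Eventually.of_forall hp.nonneg) ((part_intOn hA).1 hp.int k)).1 h
      have : ∫ x in A k, p x * Real.log (p x) = 0 := by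
        rw [integral_eq_zero_of_ae]
        filter_upwards [h'] with x hx
        simp [hx]
      rw [h, this]; simp
    · simp [h]
  · unfold diffEntropy
    rw [part_int hA fun k => (bayes_ent hA hp hf y hη k).1]
    rw [← Finset.sum_neg_distrib, Finset.mul_sum]
    refine Finset.sum_congr rfl fun k _ => ?_
    rw [(bayes_ent hA hp hf y hη k).2]
    field_simp
    ring

lemma bayes_ent_sum (hA : IsPart X A) (hp : GoodDensity X p) {f : Fin K → Y → ℝ}
    (hf : ∀ k, IsPmf (f k)) :
    ∑ y, (∑ k, (∫ x in A k, p x) * f k y) * diffEntropy X (bayesPost p A f y) =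
      diffEntropy X p - phiGen f (fun k => ∫ x in A k, p x) := by
  simp_rw [bayes_ent_y hA hp hf, Finset.sum_add_distrib, Finset.sum_sub_distrib,
    Finset.sum_neg_distrib]
  unfold phiGen shannonEntropy diffEntropy
  rw [part_int hA ((part_intOn hA).1 hp.ent)]
  have e1 : ∑ y, ∑ k, (f k y * ∫ x in A k, p x * Real.log (p x)) =
      ∑ k, ∫ x in A k, p x * Real.log (p x) := by
    rw [Finset.sum_comm]
    simp_rw [← Finset.sum_mul, (hf _).2, one_mul]
  have e2 : ∑ y, ∑ k, (∫ x in A k, p x) * (f k y * Real.log (f k y)) =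
      ∑ k, (∫ x in A k, p x) * ∑ y, (f k y * Real.log (f k y)) := by
    rw [Finset.sum_comm]
    simp_rw [← Finset.mul_sum]
  rw [e1, e2]
  simp_rw [← Finset.sum_mul, mul_neg, Finset.sum_neg_distrib]
  ring

end step

lemma gibbs_pt {q g : ℝ} (hq : 0 ≤ q) (hg : 0 < g) :
    q * Real.log g + q - g ≤ q * Real.log q := by
  rcases hq.eq_or_lt with rfl | h
  · simp [hg.le]
  have := Real.log_le_sub_one_of_pos (div_pos hg h)
  rw [Real.log_div hg.ne' h.ne'] at this
  have h2 := mul_le_mul_of_nonneg_left this h.le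
  have : q * (g / q - 1) = g - q := by field_simp
  nlinarith

lemma gauss_bound {d : ℕ} {X : Set (EuclideanSpace ℝ (Fin d))} (hX : IsCompact X)
    {q : EuclideanSpace ℝ (Fin d) → ℝ} (hq : GoodDensity X q) (m : EuclideanSpace ℝ (Fin d))
    {s : ℝ} (hs : 0 < s) :
    diffEntropy X q ≤ (d / 2) * Real.log (2 * Real.pi * s) +
      (1 / (2 * s)) * ∫ x in X, q x * ‖x - m‖ ^ 2 := by
  have hpi := Real.pi_pos
  set Z : ℝ := (2 * Real.pi * s) ^ ((d : ℝ) / 2) with hZ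
  have hZpos : 0 < Z := by positivity
  let G : EuclideanSpace ℝ (Fin d) → ℝ := fun x => Z⁻¹ * Real.exp (-(1 / (2 * s)) * ‖x - m‖ ^ 2)
  have hGpos : ∀ x, 0 < G x := fun x => by positivity
  have hG1 : ∫ x, G x = 1 := by
    have h1 : ∫ x : EuclideanSpace ℝ (Fin d), Real.exp (-(1 / (2 * s)) * ‖x - m‖ ^ 2) = Z := by
      rw [integral_sub_right_eq_self
        (fun x : EuclideanSpace ℝ (Fin d) => Real.exp (-(1 / (2 * s)) * ‖x‖ ^ 2)) m,
        GaussianFourier.integral_rexp_neg_mul_sq_norm (by positivity)]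
      simp only [finrank_euclideanSpace, Fintype.card_fin, hZ]
      congr 1
      field_simp
    simp only [G]
    rw [integral_const_mul, h1, inv_mul_cancel₀ hZpos.ne']
  have hGi : Integrable G := by
    by_contra h
    rw [integral_undef h] at hG1
    norm_num at hG1
  have hGX : ∫ x in X, G x ≤ 1 := by
    rw [← hG1]
    exact setIntegral_le_integral hGi (Filter.Eventually.of_forall fun x => (hGpos x).le)
  have hlogG : ∀ x, Real.log (G x) =
      -((d / 2) * Real.log (2 * Real.pi * s)) - (1 / (2 * s)) * ‖x - m‖ ^ 2 := by
    intro x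
    simp only [G]
    rw [Real.log_mul (by positivity) (by positivity), Real.log_exp, Real.log_inv, hZ,
      Real.log_rpow (by positivity)]
    ring
  have hV : IntegrableOn (fun x => q x * ‖x - m‖ ^ 2) X := by
    have hc : Continuous fun x : EuclideanSpace ℝ (Fin d) => ‖x - m‖ ^ 2 := by fun_prop
    obtain ⟨C, hC⟩ := hX.exists_bound_of_continuousOn hc.continuousOn
    refine Integrable.mul_bdd (c := C) hq.int hc.aestronglyMeasurable ?_
    exact (ae_restrict_mem hX.measurableSet).mono fun x hx => hC x hx
  have key : ∫ x in X, ((1 - (d / 2) * Real.log (2 * Real.pi * s)) * q x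
      - (1 / (2 * s)) * (q x * ‖x - m‖ ^ 2) - G x) ≤ ∫ x in X, q x * Real.log (q x) := by
    refine integral_mono (((hq.int.integrable.const_mul _).sub
      (hV.integrable.const_mul _)).sub hGi.integrableOn) hq.ent fun x => ?_
    have := gibbs_pt (hq.nonneg x) (hGpos x)
    rw [hlogG] at this
    simp only
    linarith
  have I1 : IntegrableOn (fun x => (1 - (d / 2) * Real.log (2 * Real.pi * s)) * q x) X :=
    hq.int.integrable.const_mul _
  have I2 : IntegrableOn (fun x => (1 / (2 * s)) * (q x * ‖x - m‖ ^ 2)) X :=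
    hV.integrable.const_mul _
  have I12 : IntegrableOn (fun x => (1 - (d / 2) * Real.log (2 * Real.pi * s)) * q x
      - (1 / (2 * s)) * (q x * ‖x - m‖ ^ 2)) X := I1.sub I2
  rw [integral_sub I12 hGi.integrableOn, integral_sub I1 I2, integral_const_mul,
    integral_const_mul, hq.one] at key
  unfold diffEntropy
  linarith

lemma main_induction {d K : ℕ} {Y : Type*} [Fintype Y]
    {X : Set (EuclideanSpace ℝ (Fin d))} (hX : IsCompact X)
    {f : Fin K → Y → ℝ} (hf : ∀ k, IsPmf (f k)) {Φ : ℝ}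
    (hmax : ∀ v ∈ stdSimplex ℝ (Fin K), phiGen f v ≤ Φ) {s : ℝ} (hs : 0 < s) (n : ℕ) :
    ∀ (policy : List Y → Fin K → Set (EuclideanSpace ℝ (Fin d)))
      (_ : ∀ h, IsPart X (policy h)) (p : EuclideanSpace ℝ (Fin d) → ℝ) (_ : GoodDensity X p),
    diffEntropy X p - n * Φ - (d / 2) * Real.log (2 * Real.pi * s) ≤
      (1 / (2 * s)) * ∑ ys : Fin n → Y,
          seqProb f policy p (List.ofFn ys) *
            ∫ x in X,
              postSeq f policy p (List.ofFn ys) x *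
                ‖x - ∫ z in X, (postSeq f policy p (List.ofFn ys) z) • z‖ ^ 2 := by
  induction n with
  | zero =>
    intro policy hpol p hp
    have := gauss_bound hX hp (∫ z in X, p z • z) hs
    simp only [Finset.univ_unique, Finset.sum_singleton, List.ofFn_zero, seqProb, postSeq, one_mul]
    push_cast
    linarith
  | succ n ih =>
    intro policy hpol p hp
    rw [← (Fin.consEquiv (fun _ : Fin (n + 1) => Y)).sum_comp, Fintype.sum_prod_type]
    have hcons : ∀ (y : Y) (v : Fin n → Y),
        List.ofFn ((Fin.consEquiv (fun _ : Fin (n + 1) => Y)) (y, v)) = y :: List.ofFn v := by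
      intro y v
      exact List.ofFn_cons y v
    simp only [hcons, seqProb, postSeq, mul_assoc]
    simp_rw [← Finset.mul_sum]
    have hA := hpol []
    have hsum : ∑ y, (∑ k, (∫ x in policy [] k, p x) * f k y) *
        (diffEntropy X (bayesPost p (policy []) f y) - n * Φ
          - (d / 2) * Real.log (2 * Real.pi * s)) ≤ _ :=
      Finset.sum_le_sum fun y _ => mul_le_mul_of_nonneg_left
        (ih (fun h => policy (y :: h)) (fun h => hpol (y :: h)) _ (bayes_good hA hp hf y))
        (eta_nonneg hp hf y)
    simp_rw [mul_left_comm _ (1 / (2 * s)), ← Finset.mul_sum] at hsum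
    refine le_trans ?_ hsum
    simp_rw [mul_sub, Finset.sum_sub_distrib, ← Finset.sum_mul]
    rw [bayes_ent_sum hA hp hf, eta_sum hA hp hf]
    have := hmax _ (u_simplex hA hp)
    rw [← mul_assoc 2 Real.pi s]
    push_cast
    linarith

/-- **Proposition 3 (MSE lower bound).** Under any policy, the mean-square
error of the conditional-mean estimator after `n` stages is at least
`(d C_0^{1/d} / (2πe)) e^{−2nφ*/d}`, where `C_0 = e^{2H(p_0)}`. -/
theorem mse_lower_bound
    {d K : ℕ} (hd : 1 ≤ d) (hK : 2 ≤ K) {Y : Type*} [Fintype Y] [Nonempty Y]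
    (X : Set (EuclideanSpace ℝ (Fin d))) (hX : IsCompact X)
    (f : Fin K → Y → ℝ) (hf : ∀ k, IsPmf (f k))
    (p0 : EuclideanSpace ℝ (Fin d) → ℝ)
    (hp0 : ∀ x, 0 ≤ p0 x)
    (hpsupp : ∀ x ∉ X, p0 x = 0)
    (hp1 : ∫ x in X, p0 x = 1)
    (n : ℕ)
    (ustar : Fin K → ℝ) (hmem : ustar ∈ stdSimplex ℝ (Fin K))
    (hmax : ∀ v ∈ stdSimplex ℝ (Fin K), phiGen f v ≤ phiGen f ustar)
    (policy : List Y → Fin K → Set (EuclideanSpace ℝ (Fin d)))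
    (hpolicy : ∀ h : List Y, (∀ k, MeasurableSet (policy h k)) ∧
      (Pairwise fun k k' => Disjoint (policy h k) (policy h k')) ∧
      (⋃ k, policy h k) = X)
    -- all posterior densities have finite differential entropy …
    (hEnt : ∀ h : List Y,
      Integrable
        (fun x => postSeq f policy p0 h x * Real.log (postSeq f policy p0 h x))
        (volume.restrict X))
    -- … and finite second moments
    (hMom : ∀ h : List Y,
      Integrable (fun x => postSeq f policy p0 h x * ‖x‖ ^ 2) (volume.restrict X))
    (hMean : ∀ h : List Y,
      Integrable (fun x => (postSeq f policy p0 h x) • x) (volume.restrict X)) :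
    (d * Real.exp (2 * diffEntropy X p0) ^ ((1 : ℝ) / d)
        / (2 * Real.pi * Real.exp 1)) *
      Real.exp (-(2 * n * phiGen f ustar) / d)
      ≤ ∑ ys : Fin n → Y,
          seqProb f policy p0 (List.ofFn ys) *
            ∫ x in X,
              postSeq f policy p0 (List.ofFn ys) x *
                ‖x - ∫ z in X, (postSeq f policy p0 (List.ofFn ys) z) • z‖ ^ 2 := by
  have hd0 : (0 : ℝ) < d := by exact_mod_cast hd
  have hpi := Real.pi_pos
  have hgood : GoodDensity X p0 := by
    refine ⟨hp0, ?_, hp1, hEnt []⟩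
    by_contra h
    rw [integral_undef h] at hp1
    norm_num at hp1
  set L : ℝ := diffEntropy X p0 - n * phiGen f ustar with hL
  set s : ℝ := Real.exp (2 * L / d - 1) / (2 * Real.pi) with hs
  have hspos : 0 < s := by positivity
  have h := main_induction hX hf hmax hspos n policy hpolicy p0 hgood
  have e1 : 2 * Real.pi * s = Real.exp (2 * L / d - 1) := by rw [hs]; field_simp
  rw [e1, Real.log_exp] at h
  have e2 : diffEntropy X p0 - n * phiGen f ustar - d / 2 * (2 * L / d - 1) = d / 2 := by
    rw [← hL]; field_simp; ring
  rw [e2, one_div, inv_mul_eq_div, le_div_iff₀ (by positivity)] at h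
  refine le_trans (le_of_eq ?_) h
  rw [← Real.exp_mul, hs, Real.exp_sub]
  have e3 : 2 * L / d = 2 * diffEntropy X p0 * (1 / d) + -(2 * n * phiGen f ustar) / d := by
    rw [hL]; ring
  rw [e3, Real.exp_add]
  field_simp
end
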